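/- arXiv:2201.13255 — 3 statements merged into one kernel-verified Lean document; each statement's English description precedes it below -/
import Mathlib

section
/- Let A ⊆ B be nonempty, let π_A = π(A)^{-1}·π|_A be the normalized restriction of π to A, and for each x ∈ B and y ∈ A let γ_{xy} be a path from x to y. Define W = max over edges e ∈ E of (w(e)²/Q(e))·Σ_{x∈B, y∈A : γ_{xy} ∋ e} |γ_{xy}|_w · π(x)·π_A(y). Then for every function u : B → ℝ one has Var_π(u) ≤ W · Σ_{e∈E} |du(e)|²·Q(e), where Var_π(u) = Σ_{x∈B} (u(x) − π(u))² π(x) and π(u) = Σ_x u(x)π(x). (In particular the spectral gap of the pair (K,π) is at least 1/W for the variational formula associated with the quadratic form Σ_{e∈E} |du(e)|²Q(e).) -/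
open Finset

/-- The increment of `u` along a list of vertices is bounded by the sum of the increments over
the distinct consecutive pairs: loops can be erased. -/
theorem abs_sub_le_sum_toFinset_zip_tail {B : Type*} [DecidableEq B] (u : B → ℝ) (y : B) :
    ∀ (l : List B) (x : B), l.head? = some x → l.getLast? = some y →
      |u y - u x| ≤ ∑ e ∈ (l.zip l.tail).toFinset, |u e.2 - u e.1|
  | [], _, hx, _ => by simp at hx
  | [a], x, hx, hy => by
    simp only [List.head?_cons, Option.some.injEq, List.getLast?_singleton] at hx hy
    simp [← hx, ← hy]
  | a :: b :: t, x, hx, hy => by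
    obtain rfl : a = x := by simpa using hx
    have hy' : (b :: t).getLast? = some y := by simpa using hy
    by_cases ha : a ∈ b :: t
    · obtain ⟨s, r, hsr⟩ := List.append_of_mem ha
      have hlen : (a :: r).length < (a :: b :: t).length := by
        simp [hsr]
      have hlast : (a :: r).getLast? = some y := by
        rw [hsr] at hy'
        simpa [List.getLast?_append] using hy'
      refine (abs_sub_le_sum_toFinset_zip_tail u y (a :: r) a rfl hlast).trans
        (sum_le_sum_of_subset_of_nonneg ?_ fun _ _ _ => abs_nonneg _)
      intro e he
      rw [List.mem_toFinset] at he ⊢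
      rw [hsr]
      have hdrop : (a :: r).zip r =
          ((a :: (s ++ a :: r)).zip (s ++ a :: r)).drop (s.length + 1) := by
        simp [List.zip_eq_zipWith, List.drop_zipWith]
      simp only [List.tail_cons] at he ⊢
      rw [hdrop] at he
      exact List.mem_of_mem_drop he
    · have ih := abs_sub_le_sum_toFinset_zip_tail u y (b :: t) b rfl hy'
      have hnot : (a, b) ∉ ((b :: t).zip (b :: t).tail).toFinset := by
        rw [List.mem_toFinset]
        exact fun h => ha (List.of_mem_zip h).1
      have hzip : ((a :: b :: t).zip (a :: b :: t).tail).toFinset =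
          insert (a, b) ((b :: t).zip (b :: t).tail).toFinset := by
        simp
      rw [hzip, sum_insert hnot]
      have := abs_sub_le (u y) (u b) (u a)
      linarith
  termination_by l => l.length
  decreasing_by
    · exact hlen
    · simp

theorem Finset.sum_toFinset_le_sum_map {ι : Type*} [DecidableEq ι] (f : ι → ℝ)
    (hf : ∀ i, 0 ≤ f i) (l : List ι) : ∑ i ∈ l.toFinset, f i ≤ (l.map f).sum := by
  rw [Finset.sum_list_map_count]
  refine sum_le_sum fun i hi => ?_
  have h : 1 ≤ l.count i := List.one_le_count_iff.2 (List.mem_toFinset.1 hi)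
  rw [nsmul_eq_mul]
  exact le_mul_of_one_le_left (hf i) (by exact_mod_cast h)

/-- Weighted Cauchy-Schwarz inequality along a path, each edge being counted once in the
energy. -/
theorem sq_sub_le_length_mul_energy {B : Type*} [DecidableEq B] (u : B → ℝ) (w : B × B → ℝ)
    {l : List B} {x y : B} (hx : l.head? = some x) (hy : l.getLast? = some y)
    (hw : ∀ e ∈ l.zip l.tail, 0 < w e) :
    (u x - u y) ^ 2 ≤ ((l.zip l.tail).map fun e => 1 / w e ^ 2).sum *
      ∑ e ∈ (l.zip l.tail).toFinset, w e ^ 2 * (u e.2 - u e.1) ^ 2 := by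
  set F := (l.zip l.tail).toFinset
  have henergy : 0 ≤ ∑ e ∈ F, w e ^ 2 * (u e.2 - u e.1) ^ 2 :=
    sum_nonneg fun _ _ => by positivity
  calc (u x - u y) ^ 2 = |u y - u x| ^ 2 := by rw [sq_abs]; ring
    _ ≤ (∑ e ∈ F, |u e.2 - u e.1|) ^ 2 := by
        gcongr
        exact abs_sub_le_sum_toFinset_zip_tail u y l x hx hy
    _ ≤ (∑ e ∈ F, 1 / w e ^ 2) * ∑ e ∈ F, w e ^ 2 * (u e.2 - u e.1) ^ 2 := by
        refine sum_sq_le_sum_mul_sum_of_sq_le_mul F (fun _ _ => by positivity)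
          (fun _ _ => by positivity) fun e he => le_of_eq ?_
        have := hw e (List.mem_toFinset.1 he)
        rw [sq_abs]
        field_simp
    _ ≤ _ := mul_le_mul_of_nonneg_right
        (sum_toFinset_le_sum_map _ (fun _ => by positivity) _) henergy

theorem variance_le_sum_sq_sub {B : Type*} [Fintype B] (p u : B → ℝ) (hp : ∑ x, p x = 1)
    (m : ℝ) :
    ∑ x, (u x - ∑ z, u z * p z) ^ 2 * p x ≤ ∑ x, (u x - m) ^ 2 * p x := by
  set c := ∑ z, u z * p z with hc
  have h : ∑ x, (u x - m) ^ 2 * p x = ∑ x, (u x - c) ^ 2 * p x + (c - m) ^ 2 := by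
    have h1 : ∀ x, (u x - m) ^ 2 * p x =
        (u x - c) ^ 2 * p x + 2 * (c - m) * (u x * p x) + ((c - m) ^ 2 - 2 * (c - m) * c) * p x :=
      fun x => by ring
    simp only [h1, sum_add_distrib, ← mul_sum, hp, ← hc]
    ring
  rw [h]
  exact le_add_of_nonneg_right (sq_nonneg _)

/-- weighted path bound for the variance with respect to a
nonempty subset `A` (Proposition `prop-W`, case of a general set `A`). -/
theorem variance_path_bound_with_set
    {B : Type*} [Fintype B] [DecidableEq B]
    (K : B → B → ℝ) (p : B → ℝ)
    (hK0 : ∀ x y, 0 ≤ K x y) (hK1 : ∀ x y, K x y ≤ 1)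
    (hKrow : ∀ x, ∑ y, K x y = 1)
    (hppos : ∀ x, 0 < p x)
    (hpsum : ∑ x, p x = 1)
    (hrev : ∀ x y, p x * K x y = p y * K y x)
    (A : Finset B) (hA : A.Nonempty)
    (w : B × B → ℝ)
    (hw : ∀ e : B × B, e.1 ≠ e.2 → 0 < p e.1 * K e.1 e.2 → 0 < w e)
    (γ : B → B → List B)
    (hγ : ∀ x : B, ∀ y ∈ A,
      (γ x y).head? = some x ∧ (γ x y).getLast? = some y ∧
      ∀ e ∈ (γ x y).zip (γ x y).tail, e.1 ≠ e.2 ∧ 0 < p e.1 * K e.1 e.2)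
    (W : ℝ)
    (hW : ∀ e : B × B, e.1 ≠ e.2 → 0 < p e.1 * K e.1 e.2 →
      (w e) ^ 2 / (p e.1 * K e.1 e.2) *
        ∑ x, ∑ y ∈ A,
          (if e ∈ (γ x y).zip (γ x y).tail then
            (((γ x y).zip (γ x y).tail).map fun e' => 1 / (w e') ^ 2).sum
              * (p x * (p y / ∑ z ∈ A, p z))
          else 0) ≤ W)
    (u : B → ℝ) :
    ∑ x, (u x - ∑ z, u z * p z) ^ 2 * p x ≤
      W * ∑ e ∈ univ.filter (fun e : B × B => e.1 ≠ e.2 ∧ 0 < p e.1 * K e.1 e.2),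
        (u e.2 - u e.1) ^ 2 * (p e.1 * K e.1 e.2) := by
  set q : B → ℝ := fun y => p y / ∑ z ∈ A, p z with hq
  have hpA : 0 < ∑ z ∈ A, p z := sum_pos (fun z _ => hppos z) hA
  have hq0 : ∀ y, 0 ≤ q y := fun y => div_nonneg (hppos y).le hpA.le
  have hqsum : ∑ y ∈ A, q y = 1 := by
    rw [hq, ← sum_div, div_self hpA.ne']
  set E := univ.filter (fun e : B × B => e.1 ≠ e.2 ∧ 0 < p e.1 * K e.1 e.2) with hE
  set f : B → B → B × B → ℝ := fun x y e =>
    if e ∈ (γ x y).zip (γ x y).tail then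
      (((γ x y).zip (γ x y).tail).map fun e' => 1 / (w e') ^ 2).sum * (p x * q y)
    else 0 with hf
  have jensen : ∀ x, (u x - ∑ y ∈ A, q y * u y) ^ 2 ≤ ∑ y ∈ A, q y * (u x - u y) ^ 2 := by
    intro x
    have h := sum_sq_le_sum_mul_sum_of_sq_le_mul A (r := fun y => q y * (u x - u y))
      (f := q) (g := fun y => q y * (u x - u y) ^ 2) (fun y _ => hq0 y)
      (fun y _ => mul_nonneg (hq0 y) (sq_nonneg _)) fun y _ => le_of_eq (by ring)
    simpa only [mul_sub, sum_sub_distrib, ← sum_mul, hqsum, one_mul] using h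
  have path : ∀ x, ∀ y ∈ A, q y * (u x - u y) ^ 2 * p x ≤
      ∑ e ∈ E, f x y e * (w e ^ 2 * (u e.2 - u e.1) ^ 2) := by
    intro x y hy
    obtain ⟨hx, hlast, hedge⟩ := hγ x y hy
    have hsq := sq_sub_le_length_mul_energy u w hx hlast
      fun e he => hw e (hedge e he).1 (hedge e he).2
    have hfilter : E.filter (· ∈ (γ x y).zip (γ x y).tail) =
        ((γ x y).zip (γ x y).tail).toFinset := by
      ext e
      simpa [hE] using hedge e
    simp only [hf, ite_mul, zero_mul]
    rw [← sum_filter, hfilter, ← mul_sum]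
    calc q y * (u x - u y) ^ 2 * p x = (p x * q y) * (u x - u y) ^ 2 := by ring
      _ ≤ _ := mul_le_mul_of_nonneg_left hsq (mul_nonneg (hppos x).le (hq0 y))
      _ = _ := by ring
  calc ∑ x, (u x - ∑ z, u z * p z) ^ 2 * p x
      ≤ ∑ x, (u x - ∑ y ∈ A, q y * u y) ^ 2 * p x := variance_le_sum_sq_sub p u hpsum _
    _ ≤ ∑ x, ∑ y ∈ A, q y * (u x - u y) ^ 2 * p x := by
        refine sum_le_sum fun x _ => ?_
        rw [← sum_mul]
        exact mul_le_mul_of_nonneg_right (jensen x) (hppos x).le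
    _ ≤ ∑ x, ∑ y ∈ A, ∑ e ∈ E, f x y e * (w e ^ 2 * (u e.2 - u e.1) ^ 2) :=
        sum_le_sum fun x _ => sum_le_sum fun y hy => path x y hy
    _ = ∑ e ∈ E, (∑ x, ∑ y ∈ A, f x y e) * (w e ^ 2 * (u e.2 - u e.1) ^ 2) := by
        simp only [sum_mul]
        rw [sum_comm (s := E)]
        exact sum_congr rfl fun x _ => sum_comm
    _ ≤ ∑ e ∈ E, W * ((u e.2 - u e.1) ^ 2 * (p e.1 * K e.1 e.2)) := by
        refine sum_le_sum fun e he => ?_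
        obtain ⟨hne, hQ⟩ := (mem_filter.1 he).2
        have hWe : w e ^ 2 / (p e.1 * K e.1 e.2) * (∑ x, ∑ y ∈ A, f x y e) ≤ W := hW e hne hQ
        have h := mul_le_mul_of_nonneg_right hWe
          (mul_nonneg (sq_nonneg (u e.2 - u e.1)) hQ.le)
        refine le_trans (le_of_eq ?_) h
        have hQ' := hQ.ne'
        generalize p e.1 * K e.1 e.2 = Q at hQ' ⊢
        generalize ∑ x, ∑ y ∈ A, f x y e = S
        field_simp
    _ = _ := (mul_sum ..).symm
end

section
/- Suppose that for every ordered pair (x,y) ∈ B×B a path γ_{xy} from x to y is chosen, and define W = max over edges e ∈ E of (w(e)²/Q(e))·Σ_{(x,y)∈B×B : γ_{xy} ∋ e} |γ_{xy}|_w · π(x)·π(y). Then for every function u : B → ℝ one has Var_π(u) ≤ (W/2) · Σ_{e∈E} |du(e)|²·Q(e), where Var_π(u) = Σ_{x∈B} (u(x) − π(u))² π(x) and π(u) = Σ_x u(x)π(x). -/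
open Finset

namespace PathBound

/-- Loop erasure: a vertex list contains a list without repetitions having the same endpoints and
using only consecutive pairs of the original list. -/
theorem exists_nodup_path {B : Type*} (x : B) (l : List B) :
    ∃ l' : List B, (x :: l').Nodup ∧ (x :: l').getLast? = (x :: l).getLast? ∧
      (x :: l').zip l' ⊆ (x :: l).zip l := by
  induction l generalizing x with
  | nil => exact ⟨[], by simp, rfl, by simp⟩
  | cons a l ih =>
    obtain ⟨l', hnd, hlast, hsub⟩ := ih a
    by_cases hx : x ∈ a :: l'
    · obtain ⟨s, t, hst⟩ := List.append_of_mem hx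
      refine ⟨t, ?_, ?_, ?_⟩
      · rw [hst] at hnd
        exact hnd.of_append_right
      · rw [hst] at hlast
        rw [List.getLast?_cons_cons, ← hlast, List.getLast?_append]
        simp [List.getLast?_cons]
      · intro e he
        rw [List.zip_cons_cons]
        refine List.mem_cons_of_mem _ (hsub ?_)
        cases s with
        | nil =>
          obtain ⟨rfl, rfl⟩ := List.cons.inj hst
          exact he
        | cons b s =>
          obtain ⟨rfl, rfl⟩ := List.cons.inj hst
          clear hst hx hsub hlast hnd
          induction s generalizing a with
          | nil => exact List.mem_cons_of_mem _ he
          | cons c s ihs => exact List.mem_cons_of_mem _ (ihs c)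
    · refine ⟨a :: l', List.nodup_cons.2 ⟨hx, hnd⟩, ?_, ?_⟩
      · rw [List.getLast?_cons_cons, hlast, List.getLast?_cons_cons]
      · rw [List.zip_cons_cons, List.zip_cons_cons]
        exact List.cons_subset_cons _ hsub

theorem sum_zip_tail_sub {B : Type*} (u : B → ℝ) (x y : B) (l : List B)
    (h : (x :: l).getLast? = some y) :
    (((x :: l).zip l).map fun e => u e.2 - u e.1).sum = u y - u x := by
  induction l generalizing x with
  | nil => simp_all
  | cons a l ih =>
    rw [List.getLast?_cons_cons] at h
    rw [List.zip_cons_cons, List.map_cons, List.sum_cons, ih a h]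
    ring

theorem nodup_zip_of_nodup {α β : Type*} (l : List α) (m : List β) (h : l.Nodup) :
    (l.zip m).Nodup := by
  induction l generalizing m with
  | nil => simp
  | cons a l ih =>
    cases m with
    | nil => simp
    | cons b m =>
      rw [List.nodup_cons] at h
      rw [List.zip_cons_cons, List.nodup_cons]
      exact ⟨fun hm => h.1 (List.of_mem_zip hm).1, ih m h.2⟩

theorem sum_toFinset_le_sum_map {α : Type*} [DecidableEq α] (f : α → ℝ) (hf : ∀ a, 0 ≤ f a)
    (l : List α) : ∑ a ∈ l.toFinset, f a ≤ (l.map f).sum := by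
  induction l with
  | nil => simp
  | cons a l ih =>
    rw [List.toFinset_cons, List.map_cons, List.sum_cons]
    by_cases ha : a ∈ l.toFinset
    · rw [Finset.insert_eq_of_mem ha]
      linarith [hf a]
    · rw [Finset.sum_insert ha]
      linarith

/-- Cauchy–Schwarz along a path, each edge of which is counted once in the energy. -/
theorem sq_sub_le_length_mul_sum {B : Type*} [DecidableEq B] (u : B → ℝ) (w : B × B → ℝ)
    (x y : B) (l : List B) (hhead : l.head? = some x) (hlast : l.getLast? = some y)
    (hw : ∀ e ∈ l.zip l.tail, 0 < w e) :
    (u y - u x) ^ 2 ≤ ((l.zip l.tail).map fun e => 1 / (w e) ^ 2).sum *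
      ∑ e ∈ (l.zip l.tail).toFinset, (w e) ^ 2 * (u e.2 - u e.1) ^ 2 := by
  cases l with
  | nil => simp at hhead
  | cons a l =>
    obtain rfl : a = x := by simpa using hhead
    rw [List.tail_cons] at hw ⊢
    obtain ⟨l', hnd, hlast', hsub⟩ := exists_nodup_path a l
    have hsubset : ((a :: l').zip l').toFinset ⊆ ((a :: l).zip l).toFinset := by
      intro e he
      rw [List.mem_toFinset] at he ⊢
      exact hsub he
    have hinv : ∀ e, 0 ≤ 1 / (w e) ^ 2 := fun e => by positivity
    rw [← sum_zip_tail_sub u a y l' (hlast'.trans hlast),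
      ← List.sum_toFinset _ (nodup_zip_of_nodup _ l' hnd)]
    refine (Finset.sum_sq_le_sum_mul_sum_of_sq_le_mul _ (f := fun e => 1 / (w e) ^ 2)
      (g := fun e => (w e) ^ 2 * (u e.2 - u e.1) ^ 2) (fun e _ => hinv e)
      (fun e _ => by positivity) ?_).trans ?_
    · intro e he
      have := hw e (hsub (List.mem_toFinset.1 he))
      exact le_of_eq (by field_simp)
    · refine mul_le_mul ?_ ?_ (Finset.sum_nonneg fun e _ => by positivity)
        (List.sum_nonneg (List.forall_mem_map.2 fun e _ => hinv e))
      · exact (Finset.sum_le_sum_of_subset_of_nonneg hsubset fun e _ _ => hinv e).trans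
          (sum_toFinset_le_sum_map _ hinv _)
      · exact Finset.sum_le_sum_of_subset_of_nonneg hsubset fun e _ _ => by positivity

theorem variance_eq_half_sum_sum {B : Type*} [Fintype B] (p u : B → ℝ) (hp : ∑ x, p x = 1) :
    ∑ x, (u x - ∑ z, u z * p z) ^ 2 * p x =
      1 / 2 * ∑ x, ∑ y, (u y - u x) ^ 2 * (p x * p y) := by
  set m := ∑ z, u z * p z with hm
  have hleft : ∑ x, (u x - m) ^ 2 * p x = ∑ x, u x ^ 2 * p x - m ^ 2 := by
    have : ∀ x, (u x - m) ^ 2 * p x = u x ^ 2 * p x - 2 * m * (u x * p x) + m ^ 2 * p x :=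
      fun x => by ring
    simp_rw [this]
    rw [Finset.sum_add_distrib, Finset.sum_sub_distrib, ← Finset.mul_sum, ← Finset.mul_sum, ← hm,
      hp]
    ring
  have hinner : ∀ x, ∑ y, (u y - u x) ^ 2 * (p x * p y) =
      (∑ y, u y ^ 2 * p y) * p x - 2 * m * (u x * p x) + u x ^ 2 * p x := by
    intro x
    have : ∀ y, (u y - u x) ^ 2 * (p x * p y) =
        p x * (u y ^ 2 * p y) - 2 * (u x * p x) * (u y * p y) + u x ^ 2 * p x * p y :=
      fun y => by ring
    simp_rw [this]
    rw [Finset.sum_add_distrib, Finset.sum_sub_distrib, ← Finset.mul_sum, ← Finset.mul_sum,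
      ← Finset.mul_sum, ← hm, hp]
    ring
  simp_rw [hleft, hinner]
  rw [Finset.sum_add_distrib, Finset.sum_sub_distrib, ← Finset.mul_sum, ← Finset.mul_sum, ← hm, hp]
  ring

end PathBound

/-- weighted path bound for the variance, paths between all
ordered pairs (Proposition `prop-W`, case `A = B`). -/
theorem variance_path_bound_all_pairs
    {B : Type*} [Fintype B] [DecidableEq B]
    (K : B → B → ℝ) (p : B → ℝ)
    (hK0 : ∀ x y, 0 ≤ K x y) (hK1 : ∀ x y, K x y ≤ 1)
    (hKrow : ∀ x, ∑ y, K x y = 1)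
    (hppos : ∀ x, 0 < p x)
    (hpsum : ∑ x, p x = 1)
    (hrev : ∀ x y, p x * K x y = p y * K y x)
    (w : B × B → ℝ)
    (hw : ∀ e : B × B, e.1 ≠ e.2 → 0 < p e.1 * K e.1 e.2 → 0 < w e)
    (γ : B → B → List B)
    (hγ : ∀ x y : B,
      (γ x y).head? = some x ∧ (γ x y).getLast? = some y ∧
      ∀ e ∈ (γ x y).zip (γ x y).tail, e.1 ≠ e.2 ∧ 0 < p e.1 * K e.1 e.2)
    (W : ℝ)
    (hW : ∀ e : B × B, e.1 ≠ e.2 → 0 < p e.1 * K e.1 e.2 →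
      (w e) ^ 2 / (p e.1 * K e.1 e.2) *
        ∑ x, ∑ y,
          (if e ∈ (γ x y).zip (γ x y).tail then
            (((γ x y).zip (γ x y).tail).map fun e' => 1 / (w e') ^ 2).sum
              * (p x * p y)
          else 0) ≤ W)
    (u : B → ℝ) :
    ∑ x, (u x - ∑ z, u z * p z) ^ 2 * p x ≤
      W / 2 * ∑ e ∈ univ.filter (fun e : B × B => e.1 ≠ e.2 ∧ 0 < p e.1 * K e.1 e.2),
        (u e.2 - u e.1) ^ 2 * (p e.1 * K e.1 e.2) := by
  rw [PathBound.variance_eq_half_sum_sum p u hpsum]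
  set E := univ.filter (fun e : B × B => e.1 ≠ e.2 ∧ 0 < p e.1 * K e.1 e.2) with hE
  set L : B → B → ℝ :=
    fun x y => (((γ x y).zip (γ x y).tail).map fun e' => 1 / (w e') ^ 2).sum with hL
  have hpath : ∀ x y, (u y - u x) ^ 2 * (p x * p y) ≤
      ∑ e ∈ E, if e ∈ (γ x y).zip (γ x y).tail then
        (w e) ^ 2 * (u e.2 - u e.1) ^ 2 * (L x y * (p x * p y)) else 0 := by
    intro x y
    obtain ⟨hhead, hlast, hedge⟩ := hγ x y
    have hfilter : E.filter (fun e => e ∈ (γ x y).zip (γ x y).tail) =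
        ((γ x y).zip (γ x y).tail).toFinset := by
      ext e
      simp only [hE, mem_filter, mem_univ, true_and, List.mem_toFinset]
      exact ⟨fun h => h.2, fun h => ⟨hedge e h, h⟩⟩
    rw [← Finset.sum_filter, hfilter, ← Finset.sum_mul]
    refine (mul_le_mul_of_nonneg_right (PathBound.sq_sub_le_length_mul_sum u w x y _ hhead hlast
      fun e he => hw e (hedge e he).1 (hedge e he).2)
      (mul_pos (hppos x) (hppos y)).le).trans_eq ?_
    ring
  have hsum : ∑ x, ∑ y, (u y - u x) ^ 2 * (p x * p y) ≤
      ∑ e ∈ E, W * ((u e.2 - u e.1) ^ 2 * (p e.1 * K e.1 e.2)) := by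
    calc
      _ ≤ ∑ x, ∑ y, ∑ e ∈ E, if e ∈ (γ x y).zip (γ x y).tail then
            (w e) ^ 2 * (u e.2 - u e.1) ^ 2 * (L x y * (p x * p y)) else 0 :=
        Finset.sum_le_sum fun x _ => Finset.sum_le_sum fun y _ => hpath x y
      _ = ∑ e ∈ E, ∑ x, ∑ y, if e ∈ (γ x y).zip (γ x y).tail then
            (w e) ^ 2 * (u e.2 - u e.1) ^ 2 * (L x y * (p x * p y)) else 0 := by
        rw [Finset.sum_comm (s := E)]
        exact Finset.sum_congr rfl fun x _ => Finset.sum_comm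
      _ ≤ _ := by
        refine Finset.sum_le_sum fun e he => ?_
        obtain ⟨hne, hQ⟩ := (mem_filter.1 he).2
        refine le_trans (le_of_eq ?_)
          (mul_le_mul_of_nonneg_right (hW e hne hQ) (mul_nonneg (sq_nonneg (u e.2 - u e.1)) hQ.le))
        simp_rw [← mul_ite_zero, ← Finset.mul_sum]
        rw [div_mul_eq_mul_div, div_mul_eq_mul_div, eq_div_iff hQ.ne']
        ring
  rw [← Finset.mul_sum] at hsum
  linarith
end

section
/- For all reals a⁻, a⁺ with 0 < a⁻ < 1 and a⁻ ≤ a⁺, there exist constants c, C > 0 depending only on a⁻ and a⁺ such that for every integer N ≥ 1 the spectral gap λ of the Metropolis chain for π_{a⁻,a⁺} on {−N,…,N} satisfies c/N² ≤ λ ≤ C/N². -/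
open Finset

/-- The unnormalized density `F(x) = (1+|x|)^{a⁻}` for `x ≤ 0` and
`(1+|x|)^{a⁺}` for `x > 0` on `ℤ`. -/
noncomputable def metroF (am ap : ℝ) (x : ℤ) : ℝ :=
  if x ≤ 0 then ((1 + |x| : ℤ) : ℝ) ^ am else ((1 + |x| : ℤ) : ℝ) ^ ap

/-- The probability measure on `{-N⁻,…,N⁺}` proportional to `metroF`. -/
noncomputable def metroPi (am ap : ℝ) (Nm Np : ℤ) (x : ℤ) : ℝ :=
  metroF am ap x / ∑ y ∈ Finset.Icc (-Nm) Np, metroF am ap y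

/-- Dirichlet form of the Metropolis chain for `metroPi` based on
nearest-neighbor random walk on `{-N⁻,…,N⁺}`. -/
noncomputable def metroDirichlet (am ap : ℝ) (Nm Np : ℤ) (u : ℤ → ℝ) : ℝ :=
  ∑ x ∈ Finset.Icc (-Nm) (Np - 1),
    (u (x + 1) - u x) ^ 2 *
      (1 / 2 * min (metroPi am ap Nm Np x) (metroPi am ap Nm Np (x + 1)))

/-- Variance with respect to `metroPi`. -/
noncomputable def metroVar (am ap : ℝ) (Nm Np : ℤ) (u : ℤ → ℝ) : ℝ :=
  ∑ x ∈ Finset.Icc (-Nm) Np,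
    (u x - ∑ y ∈ Finset.Icc (-Nm) Np, u y * metroPi am ap Nm Np y) ^ 2 *
      metroPi am ap Nm Np x

/-- Spectral gap of the Metropolis chain:
`λ = inf { ℰ(u,u)/Var_π(u) : Var_π(u) ≠ 0 }`. -/
noncomputable def metroGap (am ap : ℝ) (Nm Np : ℤ) : ℝ :=
  sInf {r : ℝ | ∃ u : ℤ → ℝ, metroVar am ap Nm Np u ≠ 0 ∧
    r = metroDirichlet am ap Nm Np u / metroVar am ap Nm Np u}
lemma metroF_of_nonpos {am ap : ℝ} {x : ℤ} (hx : x ≤ 0) :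
    metroF am ap x = (1 - (x : ℝ)) ^ am := by
  simp [metroF, hx, abs_of_nonpos, sub_eq_add_neg]

lemma metroF_of_nonneg {am ap : ℝ} {x : ℤ} (hx : 0 ≤ x) :
    metroF am ap x = (1 + (x : ℝ)) ^ ap := by
  rcases hx.eq_or_lt with rfl | hx
  · simp [metroF]
  · simp [metroF, hx.not_ge, abs_of_pos (Int.cast_pos.2 hx : (0 : ℝ) < x)]

lemma metroF_pos (am ap : ℝ) (x : ℤ) : 0 < metroF am ap x := by
  have h : (0 : ℝ) < ((1 + |x| : ℤ) : ℝ) := by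
    exact_mod_cast (by positivity : 0 < 1 + |x|)
  unfold metroF
  split_ifs <;> exact Real.rpow_pos_of_pos h _

lemma metroF_mono_of_nonneg {am ap : ℝ} (hap : 0 ≤ ap) {x y : ℤ} (hx : 0 ≤ x) (hxy : x ≤ y) :
    metroF am ap x ≤ metroF am ap y := by
  have hx' : (0 : ℝ) ≤ x := by exact_mod_cast hx
  have hxy' : (x : ℝ) ≤ y := by exact_mod_cast hxy
  rw [metroF_of_nonneg hx, metroF_of_nonneg (hx.trans hxy)]
  exact Real.rpow_le_rpow (by linarith) (by linarith) hap

lemma metroF_le {am ap : ℝ} (h0 : 0 ≤ am) (hle : am ≤ ap) {N x : ℤ} (hx : -N ≤ x) (hx' : x ≤ N) :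
    metroF am ap x ≤ ((N : ℝ) + 1) ^ ap := by
  have h1 : -(N : ℝ) ≤ x := by exact_mod_cast hx
  have h2 : (x : ℝ) ≤ N := by exact_mod_cast hx'
  rcases le_total x 0 with h | h
  · have h3 : (x : ℝ) ≤ 0 := by exact_mod_cast h
    rw [metroF_of_nonpos h]
    exact (Real.rpow_le_rpow (by linarith) (by linarith) h0).trans
      (Real.rpow_le_rpow_of_exponent_le (by linarith) hle)
  · have h3 : (0 : ℝ) ≤ x := by exact_mod_cast h
    rw [metroF_of_nonneg h]
    exact Real.rpow_le_rpow (by linarith) (by linarith) (h0.trans hle)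

lemma sum_metroF_pos (am ap : ℝ) {N : ℤ} (hN : 0 ≤ N) :
    0 < ∑ y ∈ Finset.Icc (-N) N, metroF am ap y :=
  Finset.sum_pos (fun x _ => metroF_pos am ap x) ⟨0, by simp [hN]⟩

lemma sum_metroPi (am ap : ℝ) {N : ℤ} (hN : 0 ≤ N) :
    ∑ y ∈ Finset.Icc (-N) N, metroPi am ap N N y = 1 := by
  unfold metroPi
  rw [← Finset.sum_div, div_self (sum_metroF_pos am ap hN).ne']

lemma metroPi_nonneg (am ap : ℝ) {N : ℤ} (hN : 0 ≤ N) (x : ℤ) : 0 ≤ metroPi am ap N N x :=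
  div_nonneg (metroF_pos am ap x).le (sum_metroF_pos am ap hN).le

lemma metroVar_nonneg (am ap : ℝ) {N : ℤ} (hN : 0 ≤ N) (u : ℤ → ℝ) :
    0 ≤ metroVar am ap N N u :=
  Finset.sum_nonneg fun x _ => mul_nonneg (sq_nonneg _) (metroPi_nonneg am ap hN x)

lemma metroDirichlet_nonneg (am ap : ℝ) {N : ℤ} (hN : 0 ≤ N) (u : ℤ → ℝ) :
    0 ≤ metroDirichlet am ap N N u :=
  Finset.sum_nonneg fun x _ => mul_nonneg (sq_nonneg _) <| mul_nonneg (by norm_num) <|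
    le_min (metroPi_nonneg am ap hN x) (metroPi_nonneg am ap hN (x + 1))

/-- The minimal value of the second moment about a point is the variance. -/
lemma sum_sub_mean_sq_le {ι : Type*} (s : Finset ι) (p u : ι → ℝ) (hp : ∑ i ∈ s, p i = 1) (c : ℝ) :
    ∑ i ∈ s, (u i - ∑ j ∈ s, u j * p j) ^ 2 * p i ≤ ∑ i ∈ s, (u i - c) ^ 2 * p i := by
  set m := ∑ j ∈ s, u j * p j with hm
  have key : ∑ i ∈ s, (u i - c) ^ 2 * p i
      = ∑ i ∈ s, (u i - m) ^ 2 * p i + (m - c) ^ 2 := by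
    have : ∀ i ∈ s, (u i - c) ^ 2 * p i
        = (u i - m) ^ 2 * p i + (2 * (m - c) * (u i * p i) + (c ^ 2 - m ^ 2) * p i) :=
      fun i _ => by ring
    rw [Finset.sum_congr rfl this, Finset.sum_add_distrib, Finset.sum_add_distrib,
      ← Finset.mul_sum, ← Finset.mul_sum, hp, ← hm]
    ring
  rw [key]
  linarith [sq_nonneg (m - c)]

lemma sum_Ico_int_sub (u : ℤ → ℝ) {m n : ℤ} (h : m ≤ n) :
    ∑ x ∈ Finset.Ico m n, (u (x + 1) - u x) = u n - u m := by
  induction n, h using Int.leInduction with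
  | base => simp
  | succ n hn ih =>
    have : Finset.Ico m (n + 1) = insert n (Finset.Ico m n) := by
      ext x; simp only [Finset.mem_Ico, Finset.mem_insert]; omega
    rw [this, Finset.sum_insert (by simp), ih]
    ring

/-- A concave power is dominated from below by its derivative at the right endpoint. -/
lemma inv_rpow_le_sub {a t : ℝ} (h0 : 0 < a) (h1 : a < 1) (ht : 1 ≤ t) :
    (t ^ a)⁻¹ ≤ t ^ (1 - a) / (1 - a) - (t - 1) ^ (1 - a) / (1 - a) := by
  have ht0 : 0 < t := by linarith
  have hb : 0 < 1 - a := by linarith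
  have hinv : t⁻¹ ≤ 1 := inv_le_one_of_one_le₀ ht
  have bern := rpow_one_add_le_one_add_mul_self (s := -t⁻¹) (by linarith) hb.le (by linarith)
  have hmul : (t - 1) ^ (1 - a) = t ^ (1 - a) * (1 + -t⁻¹) ^ (1 - a) := by
    rw [← Real.mul_rpow ht0.le (by linarith)]
    congr 1
    field_simp
    ring
  have hdiv : (t ^ a)⁻¹ = t ^ (1 - a) * t⁻¹ := by
    rw [Real.rpow_sub ht0, Real.rpow_one]
    field_simp
  rw [← sub_div, le_div_iff₀ hb, hmul, hdiv]
  nlinarith [mul_le_mul_of_nonneg_left bern (Real.rpow_nonneg ht0.le (1 - a))]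

/-- The effective resistance of the path `{-N,…,N}` with conductances
`min (F x) (F (x+1))` is at most `2 N^{1-a⁻} / (1-a⁻)`. -/
lemma sum_inv_min_metroF_le {am ap : ℝ} (h0 : 0 < am) (h1 : am < 1) (hle : am ≤ ap)
    {N : ℤ} (hN : 1 ≤ N) :
    ∑ x ∈ Finset.Ico (-N) N, (min (metroF am ap x) (metroF am ap (x + 1)))⁻¹
      ≤ 2 / (1 - am) * (N : ℝ) ^ (1 - am) := by
  let G : ℤ → ℝ := fun x =>
    if x ≤ 0 then -((-(x : ℝ)) ^ (1 - am) / (1 - am)) else (x : ℝ) ^ (1 - am) / (1 - am)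
  have hz : (0 : ℝ) ^ (1 - am) = 0 := Real.zero_rpow (by linarith)
  have hG : ∀ x ∈ Finset.Ico (-N) N,
      (min (metroF am ap x) (metroF am ap (x + 1)))⁻¹ ≤ G (x + 1) - G x := by
    intro x _
    rcases lt_or_ge x 0 with hx | hx
    · have hx' : (x : ℝ) ≤ -1 := by exact_mod_cast (by omega : x ≤ -1)
      have hmin : min (metroF am ap x) (metroF am ap (x + 1)) = (-(x : ℝ)) ^ am := by
        rw [metroF_of_nonpos hx.le, metroF_of_nonpos (by omega : x + 1 ≤ 0), min_eq_right]
        · push_cast; ring_nf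
        · push_cast; exact Real.rpow_le_rpow (by linarith) (by linarith) h0.le
      have hs := inv_rpow_le_sub h0 h1 (t := -(x : ℝ)) (by linarith)
      have e : (-(x : ℝ) - 1) = -((x : ℝ) + 1) := by ring
      rw [e] at hs
      simp only [G, hx.le, (by omega : x + 1 ≤ 0), if_true, hmin]
      push_cast
      linarith
    · have hx' : (0 : ℝ) ≤ x := by exact_mod_cast hx
      have hmin : ((x : ℝ) + 1) ^ am ≤ min (metroF am ap x) (metroF am ap (x + 1)) := by
        rw [min_eq_left (metroF_mono_of_nonneg (h0.le.trans hle) hx (by omega)),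
          metroF_of_nonneg hx, add_comm]
        exact Real.rpow_le_rpow_of_exponent_le (by linarith) hle
      have hs := inv_rpow_le_sub h0 h1 (t := (x : ℝ) + 1) (by linarith)
      refine (inv_anti₀ (Real.rpow_pos_of_pos (by linarith) _) hmin).trans (hs.trans_eq ?_)
      have hGx : G x = (x : ℝ) ^ (1 - am) / (1 - am) := by
        rcases hx.eq_or_lt with rfl | h
        · simp [G, hz]
        · simp [G, h.not_ge]
      have hG1 : G (x + 1) = ((x : ℝ) + 1) ^ (1 - am) / (1 - am) := by
        have h : ¬ x + 1 ≤ 0 := by omega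
        simp only [G, if_neg h]
        push_cast
        rfl
      rw [hGx, hG1]
      ring_nf
  refine (Finset.sum_le_sum hG).trans_eq ?_
  rw [sum_Ico_int_sub G (by omega)]
  have hNpos : ¬ N ≤ 0 := by omega
  have hNneg : -N ≤ 0 := by omega
  simp only [G, if_neg hNpos, if_pos hNneg]
  push_cast
  rw [neg_neg]
  ring

/-- Pointwise comparison of `(u(N) - u(x))² F(x)` with the unnormalized Dirichlet form. -/
lemma sub_sq_mul_metroF_le {am ap : ℝ} (h0 : 0 < am) (h1 : am < 1) (hle : am ≤ ap)
    {N : ℤ} (hN : 1 ≤ N) (u : ℤ → ℝ) {x : ℤ} (hx : x ∈ Finset.Icc (-N) N) :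
    (u x - u N) ^ 2 * metroF am ap x ≤ 2 / (1 - am) * ((N : ℝ) + 1) *
      ∑ y ∈ Finset.Ico (-N) N,
        (u (y + 1) - u y) ^ 2 * min (metroF am ap y) (metroF am ap (y + 1)) := by
  rw [Finset.mem_Icc] at hx
  set w : ℤ → ℝ := fun y => min (metroF am ap y) (metroF am ap (y + 1)) with hw
  set E := ∑ y ∈ Finset.Ico (-N) N, (u (y + 1) - u y) ^ 2 * w y with hE
  have hwpos : ∀ y, 0 < w y := fun y => lt_min (metroF_pos am ap _) (metroF_pos am ap _)
  have hE0 : 0 ≤ E := Finset.sum_nonneg fun y _ => mul_nonneg (sq_nonneg _) (hwpos y).le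
  have hN' : (1 : ℝ) ≤ N := by exact_mod_cast hN
  have hb : 0 < 1 - am := by linarith
  have hsub : Finset.Ico x N ⊆ Finset.Ico (-N) N := Finset.Ico_subset_Ico_left hx.1
  have hEx : ∑ y ∈ Finset.Ico x N, (u (y + 1) - u y) ^ 2 * w y ≤ E :=
    Finset.sum_le_sum_of_subset_of_nonneg hsub fun y _ _ => mul_nonneg (sq_nonneg _) (hwpos y).le
  have hcs : (u x - u N) ^ 2 ≤ E * ∑ y ∈ Finset.Ico x N, (w y)⁻¹ := by
    have : (u x - u N) ^ 2 = (∑ y ∈ Finset.Ico x N, (u (y + 1) - u y)) ^ 2 := by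
      rw [sum_Ico_int_sub u hx.2]; ring
    rw [this]
    refine (Finset.sum_sq_le_sum_mul_sum_of_sq_le_mul _
      (f := fun y => (u (y + 1) - u y) ^ 2 * w y) (g := fun y => (w y)⁻¹)
      (fun y _ => mul_nonneg (sq_nonneg _) (hwpos y).le) (fun y _ => (inv_pos.2 (hwpos y)).le)
      (fun y _ => ?_)).trans ?_
    · rw [mul_assoc, mul_inv_cancel₀ (hwpos y).ne', mul_one]
    · exact mul_le_mul_of_nonneg_right hEx
        (Finset.sum_nonneg fun y _ => (inv_pos.2 (hwpos y)).le)
  have hF := metroF_pos am ap x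
  have hmain : (∑ y ∈ Finset.Ico x N, (w y)⁻¹) * metroF am ap x
      ≤ 2 / (1 - am) * ((N : ℝ) + 1) := by
    rcases le_total x 0 with h | h
    · have hR : ∑ y ∈ Finset.Ico x N, (w y)⁻¹ ≤ 2 / (1 - am) * ((N : ℝ) + 1) ^ (1 - am) := by
        refine (Finset.sum_le_sum_of_subset_of_nonneg hsub
          fun y _ _ => (inv_pos.2 (hwpos y)).le).trans
          ((sum_inv_min_metroF_le h0 h1 hle hN).trans ?_)
        exact mul_le_mul_of_nonneg_left
          (Real.rpow_le_rpow (by linarith) (by linarith) hb.le) (by positivity)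
      have hFx : metroF am ap x ≤ ((N : ℝ) + 1) ^ am := by
        have h2 : -(N : ℝ) ≤ x := by exact_mod_cast hx.1
        have h3 : (x : ℝ) ≤ 0 := by exact_mod_cast h
        rw [metroF_of_nonpos h]
        exact Real.rpow_le_rpow (by linarith) (by linarith) h0.le
      refine (mul_le_mul hR hFx hF.le (by positivity)).trans_eq ?_
      rw [mul_assoc, ← Real.rpow_add (by linarith)]
      simp
    · have hw' : ∀ y ∈ Finset.Ico x N, (w y)⁻¹ ≤ (metroF am ap x)⁻¹ := by
        intro y hy
        rw [Finset.mem_Ico] at hy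
        refine inv_anti₀ hF (le_min ?_ ?_) <;>
          exact metroF_mono_of_nonneg (h0.le.trans hle) h (by omega)
      have hcard : ((Finset.Ico x N).card : ℝ) ≤ N := by
        have : ((Finset.Ico x N).card : ℤ) ≤ N := by rw [Int.card_Ico]; omega
        exact_mod_cast this
      have h2 : 1 ≤ 2 / (1 - am) := by rw [le_div_iff₀ hb]; linarith
      calc (∑ y ∈ Finset.Ico x N, (w y)⁻¹) * metroF am ap x
          ≤ ((Finset.Ico x N).card • (metroF am ap x)⁻¹) * metroF am ap x :=
            mul_le_mul_of_nonneg_right (Finset.sum_le_card_nsmul _ _ _ hw') hF.le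
        _ = (Finset.Ico x N).card := by rw [nsmul_eq_mul]; field_simp
        _ ≤ 1 * ((N : ℝ) + 1) := by linarith
        _ ≤ _ := mul_le_mul_of_nonneg_right h2 (by linarith)
  calc (u x - u N) ^ 2 * metroF am ap x
      ≤ (E * ∑ y ∈ Finset.Ico x N, (w y)⁻¹) * metroF am ap x :=
        mul_le_mul_of_nonneg_right hcs hF.le
    _ = ((∑ y ∈ Finset.Ico x N, (w y)⁻¹) * metroF am ap x) * E := by ring
    _ ≤ _ := mul_le_mul_of_nonneg_right hmain hE0

lemma card_Icc_neg_self {N : ℤ} (hN : 0 ≤ N) :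
    ((Finset.Icc (-N) N).card : ℝ) = 2 * N + 1 := by
  have : ((Finset.Icc (-N) N).card : ℤ) = 2 * N + 1 := by rw [Int.card_Icc]; omega
  exact_mod_cast this

lemma metroDirichlet_eq (am ap : ℝ) {N : ℤ} (hN : 0 ≤ N) (u : ℤ → ℝ) :
    metroDirichlet am ap N N u = (∑ y ∈ Finset.Ico (-N) N,
        (u (y + 1) - u y) ^ 2 * min (metroF am ap y) (metroF am ap (y + 1))) /
      (2 * ∑ y ∈ Finset.Icc (-N) N, metroF am ap y) := by
  have hI : Finset.Icc (-N) (N - 1) = Finset.Ico (-N) N := by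
    ext x; simp only [Finset.mem_Ico, Finset.mem_Icc]; omega
  have hZ := sum_metroF_pos am ap hN
  unfold metroDirichlet metroPi
  rw [hI, Finset.sum_div]
  refine Finset.sum_congr rfl fun x _ => ?_
  rw [min_div_div_right hZ.le]
  field_simp

lemma metroVar_le {am ap : ℝ} (h0 : 0 < am) (h1 : am < 1) (hle : am ≤ ap)
    {N : ℤ} (hN : 1 ≤ N) (u : ℤ → ℝ) :
    metroVar am ap N N u ≤ 24 / (1 - am) * (N : ℝ) ^ 2 * metroDirichlet am ap N N u := by
  have hN' : (1 : ℝ) ≤ N := by exact_mod_cast hN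
  have hN0 : 0 ≤ N := by omega
  have hb : 0 < 1 - am := by linarith
  have hZ := sum_metroF_pos am ap hN0
  refine (sum_sub_mean_sq_le _ _ u (sum_metroPi am ap hN0) (u N)).trans ?_
  have hsum := Finset.sum_le_card_nsmul _ _ _
    fun x hx => sub_sq_mul_metroF_le h0 h1 hle hN u (x := x) hx
  rw [metroDirichlet_eq am ap hN0]
  set E := ∑ y ∈ Finset.Ico (-N) N,
    (u (y + 1) - u y) ^ 2 * min (metroF am ap y) (metroF am ap (y + 1))
  have hE0 : 0 ≤ E := Finset.sum_nonneg fun y _ => mul_nonneg (sq_nonneg _)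
    (le_min (metroF_pos am ap _).le (metroF_pos am ap _).le)
  rw [nsmul_eq_mul, card_Icc_neg_self hN0] at hsum
  simp only [metroPi, ← mul_div_assoc]
  rw [← Finset.sum_div, ← div_div, div_le_div_iff_of_pos_right hZ]
  refine hsum.trans ?_
  have hEK : 0 ≤ E / (1 - am) := by positivity
  have : (2 * (N : ℝ) + 1) * (N + 1) ≤ 6 * N ^ 2 := by nlinarith
  calc (2 * (N : ℝ) + 1) * (2 / (1 - am) * (N + 1) * E)
      = ((2 * (N : ℝ) + 1) * (N + 1)) * (2 * (E / (1 - am))) := by ring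
    _ ≤ (6 * N ^ 2) * (2 * (E / (1 - am))) := by gcongr
    _ = _ := by ring

lemma sum_range_sub_sq (n : ℕ) (m : ℝ) :
    ∑ i ∈ Finset.range (n + 1), ((i : ℝ) - m) ^ 2
      = n * (n + 1) * (n + 2) / 12 + (n + 1) * (m - n / 2) ^ 2 := by
  induction n with
  | zero => simp
  | succ n ih =>
    rw [Finset.sum_range_succ, ih]
    push_cast
    ring

/-- Second moments of `F` over the upper half of `{0,…,N}`. -/
lemma le_sum_sub_sq_mul_metroF {am ap : ℝ} (hap : 0 ≤ ap) {N : ℤ} (hN : 1 ≤ N) (m : ℝ) :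
    (N : ℝ) ^ 3 / 96 * (((N : ℝ) + 1) / 2) ^ ap
      ≤ ∑ x ∈ Finset.Icc (-N) N, ((x : ℝ) - m) ^ 2 * metroF am ap x := by
  have hN' : (1 : ℝ) ≤ N := by exact_mod_cast hN
  obtain ⟨n, hn⟩ : ∃ n : ℕ, (n : ℤ) = N - N / 2 := ⟨(N - N / 2).toNat, by omega⟩
  have hn2 : (N : ℝ) / 2 ≤ n := by
    have : N ≤ 2 * (n : ℤ) := by omega
    have : (N : ℝ) ≤ 2 * n := by exact_mod_cast this
    linarith
  set S := (Finset.range (n + 1)).image fun i : ℕ => N / 2 + (i : ℤ) with hS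
  have hinj : Set.InjOn (fun i : ℕ => N / 2 + (i : ℤ)) (Finset.range (n + 1)) := by
    intro i _ j _ h
    simpa using h
  have hsub : S ⊆ Finset.Icc (-N) N := by
    intro x hx
    simp only [hS, Finset.mem_image, Finset.mem_range] at hx
    obtain ⟨i, hi, rfl⟩ := hx
    rw [Finset.mem_Icc]
    omega
  have hFS : ∀ x ∈ S, (((N : ℝ) + 1) / 2) ^ ap ≤ metroF am ap x := by
    intro x hx
    simp only [hS, Finset.mem_image, Finset.mem_range] at hx
    obtain ⟨i, hi, rfl⟩ := hx
    rw [metroF_of_nonneg (by omega)]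
    have : N ≤ 2 * (N / 2 + (i : ℤ)) + 1 := by omega
    have : (N : ℝ) ≤ 2 * ((N / 2 + (i : ℤ) : ℤ) : ℝ) + 1 := by exact_mod_cast this
    exact Real.rpow_le_rpow (by linarith) (by linarith) hap
  have hsq : (N : ℝ) ^ 3 / 96 ≤ ∑ x ∈ S, ((x : ℝ) - m) ^ 2 := by
    rw [hS, Finset.sum_image hinj]
    have : ∀ i ∈ Finset.range (n + 1), (((N / 2 + (i : ℤ) : ℤ) : ℝ) - m) ^ 2
        = ((i : ℝ) - (m - ((N / 2 : ℤ) : ℝ))) ^ 2 := fun i _ => by push_cast; ring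
    rw [Finset.sum_congr rfl this, sum_range_sub_sq]
    have h3 : ((N : ℝ) / 2) ^ 3 ≤ (n : ℝ) ^ 3 := pow_le_pow_left₀ (by linarith) hn2 3
    have hn0 : (0 : ℝ) ≤ n := n.cast_nonneg
    have : 0 ≤ ((n : ℝ) + 1) * (m - ((N / 2 : ℤ) : ℝ) - n / 2) ^ 2 := by positivity
    nlinarith
  calc (N : ℝ) ^ 3 / 96 * (((N : ℝ) + 1) / 2) ^ ap
      ≤ (∑ x ∈ S, ((x : ℝ) - m) ^ 2) * (((N : ℝ) + 1) / 2) ^ ap := by gcongr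
    _ = ∑ x ∈ S, ((x : ℝ) - m) ^ 2 * (((N : ℝ) + 1) / 2) ^ ap := Finset.sum_mul _ _ _
    _ ≤ ∑ x ∈ S, ((x : ℝ) - m) ^ 2 * metroF am ap x :=
        Finset.sum_le_sum fun x hx => mul_le_mul_of_nonneg_left (hFS x hx) (sq_nonneg _)
    _ ≤ _ := Finset.sum_le_sum_of_subset_of_nonneg hsub
        fun x _ _ => mul_nonneg (sq_nonneg _) (metroF_pos am ap x).le

lemma le_metroVar_cast {am ap : ℝ} (h0 : 0 ≤ am) (hle : am ≤ ap) {N : ℤ} (hN : 1 ≤ N) :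
    (N : ℝ) ^ 2 / (288 * 2 ^ ap) ≤ metroVar am ap N N (fun x => (x : ℝ)) := by
  have hN' : (1 : ℝ) ≤ N := by exact_mod_cast hN
  have hN0 : 0 ≤ N := by omega
  have hZ := sum_metroF_pos am ap hN0
  have hZle : ∑ y ∈ Finset.Icc (-N) N, metroF am ap y ≤ 3 * N * ((N : ℝ) + 1) ^ ap := by
    refine (Finset.sum_le_card_nsmul _ _ _ fun x hx =>
      metroF_le h0 hle (Finset.mem_Icc.1 hx).1 (Finset.mem_Icc.1 hx).2).trans ?_
    rw [nsmul_eq_mul, card_Icc_neg_self hN0]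
    gcongr
    linarith
  unfold metroVar
  set m := ∑ y ∈ Finset.Icc (-N) N, (y : ℝ) * metroPi am ap N N y
  simp only [metroPi, ← mul_div_assoc]
  rw [← Finset.sum_div, le_div_iff₀ hZ]
  refine le_trans ?_ (le_sum_sub_sq_mul_metroF (h0.trans hle) hN m)
  rw [Real.div_rpow (by linarith) (by norm_num)]
  have h2 : (0 : ℝ) < 2 ^ ap := by positivity
  calc (N : ℝ) ^ 2 / (288 * 2 ^ ap) * ∑ y ∈ Finset.Icc (-N) N, metroF am ap y
      ≤ (N : ℝ) ^ 2 / (288 * 2 ^ ap) * (3 * N * ((N : ℝ) + 1) ^ ap) := by gcongr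
    _ = _ := by field_simp; ring

lemma metroDirichlet_cast_le (am ap : ℝ) {N : ℤ} (hN : 0 ≤ N) :
    metroDirichlet am ap N N (fun x => (x : ℝ)) ≤ 1 / 2 := by
  have hZ := sum_metroF_pos am ap hN
  rw [metroDirichlet_eq am ap hN, div_le_div_iff₀ (by positivity) (by norm_num)]
  have : ∑ y ∈ Finset.Ico (-N) N, (((y + 1 : ℤ) : ℝ) - (y : ℝ)) ^ 2 *
      min (metroF am ap y) (metroF am ap (y + 1)) ≤ ∑ y ∈ Finset.Icc (-N) N, metroF am ap y := by
    refine (Finset.sum_le_sum fun y _ => ?_).trans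
      (Finset.sum_le_sum_of_subset_of_nonneg Finset.Ico_subset_Icc_self
        fun y _ _ => (metroF_pos am ap y).le)
    push_cast
    simp
  linarith

/-- for `0 < a⁻ < 1`, `a⁻ ≤ a⁺`, the spectral gap on `{-N,…,N}`
is of order `1/N²`. -/
theorem gap_symmetric_sublinear (am ap : ℝ) (h0 : 0 < am) (h1 : am < 1) (hle : am ≤ ap) :
    ∃ c C : ℝ, 0 < c ∧ 0 < C ∧ ∀ N : ℤ, 1 ≤ N →
      c / (N : ℝ) ^ 2 ≤ metroGap am ap N N ∧ metroGap am ap N N ≤ C / (N : ℝ) ^ 2 := by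
  have hb : 0 < 1 - am := by linarith
  refine ⟨(1 - am) / 24, 144 * 2 ^ ap, by positivity, by positivity, fun N hN => ?_⟩
  have hN' : (1 : ℝ) ≤ N := by exact_mod_cast hN
  have hN0 : 0 ≤ N := by omega
  have hV := le_metroVar_cast h0.le hle hN
  have hV0 : 0 < (N : ℝ) ^ 2 / (288 * 2 ^ ap) := by positivity
  have hV1 := hV0.trans_le hV
  refine ⟨le_csInf ⟨_, _, hV1.ne', rfl⟩ ?_, ?_⟩
  · rintro r ⟨u, hu, rfl⟩
    have hpos := (metroVar_nonneg am ap hN0 u).lt_of_ne' hu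
    rw [div_div, div_le_div_iff₀ (by positivity) hpos]
    calc (1 - am) * metroVar am ap N N u
        ≤ (1 - am) * (24 / (1 - am) * (N : ℝ) ^ 2 * metroDirichlet am ap N N u) :=
          mul_le_mul_of_nonneg_left (metroVar_le h0 h1 hle hN u) hb.le
      _ = _ := by field_simp
  · have hle_ratio : metroGap am ap N N ≤ metroDirichlet am ap N N (fun x => (x : ℝ)) /
        metroVar am ap N N (fun x => (x : ℝ)) := by
      refine csInf_le ⟨0, ?_⟩ ⟨_, hV1.ne', rfl⟩
      rintro r ⟨u, _, rfl⟩
      exact div_nonneg (metroDirichlet_nonneg am ap hN0 u) (metroVar_nonneg am ap hN0 u)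
    refine hle_ratio.trans <|
      (div_le_div₀ (by norm_num) (metroDirichlet_cast_le am ap hN0) hV0 hV).trans_eq ?_
    field_simp
    norm_num
end
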